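/- arXiv:1507.05566 — 2 statements merged into one kernel-verified Lean document; each statement's English description precedes it below -/
import Mathlib

section
/- (Osgood's Lemma.) Let t₀ < T, let ρ : [t₀, T] → (0, ∞) be measurable and bounded, let γ : [t₀, T] → (0, ∞) be locally integrable, let μ : (0, ∞) → (0, ∞) be continuous and increasing, and let β > 0. Assume that for every t ∈ [t₀, T], ρ(t) ≤ β + ∫_{t₀}^t γ(s) μ(ρ(s)) ds. Then for every t ∈ [t₀, T], −Φ(ρ(t)) + Φ(β) ≤ ∫_{t₀}^t γ(s) ds, where Φ(x) := ∫_x^1 dr/μ(r). -/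
open MeasureTheory

/-- If the increment inequality `R y - R x ≤ m (R y) * (G y - G x)` holds with `m`
positive, continuous and monotone, then `∫_{R a}^{R t} dr / m r ≤ G t - G a`. -/
lemma integral_one_div_le_of_increment_le {a b : ℝ} {R G m : ℝ → ℝ}
    (hR : ContinuousOn R (Set.Icc a b)) (hRmono : MonotoneOn R (Set.Icc a b))
    (hRpos : ∀ t ∈ Set.Icc a b, 0 < R t)
    (hG : ContinuousOn G (Set.Icc a b)) (hGmono : MonotoneOn G (Set.Icc a b))
    (hmc : ContinuousOn m (Set.Ioi 0)) (hmmono : MonotoneOn m (Set.Ioi 0))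
    (hmpos : ∀ x > (0 : ℝ), 0 < m x)
    (hinc : ∀ x ∈ Set.Icc a b, ∀ y ∈ Set.Icc a b, x ≤ y →
      R y - R x ≤ m (R y) * (G y - G x)) :
    ∀ t ∈ Set.Icc a b, ∫ r in (R a)..(R t), 1 / m r ≤ G t - G a := by
  intro t ht
  have hab : a ≤ b := ht.1.trans ht.2
  have ha : a ∈ Set.Icc a b := Set.left_mem_Icc.2 hab
  have hb : b ∈ Set.Icc a b := Set.right_mem_Icc.2 hab
  have hinv : ContinuousOn (fun r => 1 / m r) (Set.Ioi 0) :=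
    continuousOn_const.div hmc fun x hx => (hmpos x hx).ne'
  have hint : ∀ x y : ℝ, 0 < x → 0 < y →
      IntervalIntegrable (fun r => 1 / m r) volume x y := fun x y hx hy =>
    (hinv.mono fun z hz => lt_of_lt_of_le (lt_min hx hy) hz.1).intervalIntegrable
  have hFR : ContinuousOn (fun t => ∫ r in (R a)..(R t), 1 / m r) (Set.Icc a b) := by
    have hF := intervalIntegral.continuousOn_primitive_interval'
      (hint (R a) (R b) (hRpos a ha) (hRpos b hb)) Set.left_mem_uIcc
    refine hF.comp hR fun s hs => ?_
    exact Set.Icc_subset_uIcc ⟨hRmono ha hs hs.1, hRmono hs hb hs.2⟩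
  have key : ∀ ε > (0 : ℝ), ∫ r in (R a)..(R t), 1 / m r ≤ (1 + ε) * (G t - G a) := by
    intro ε hε
    refine IsClosed.Icc_subset_of_forall_exists_gt
      (s := {t | ∫ r in (R a)..(R t), 1 / m r ≤ (1 + ε) * (G t - G a)}) ?_ ?_ ?_ ht
    · have := isClosed_Icc.isClosed_le hFR
        (continuousOn_const.mul (hG.sub continuousOn_const) :
          ContinuousOn (fun t => (1 + ε) * (G t - G a)) (Set.Icc a b))
      convert this using 1
      ext z
      simp [and_comm]
    · simp
    · rintro x ⟨hx, hxab⟩ y hxy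
      have hxI : x ∈ Set.Icc a b := Set.Ico_subset_Icc_self hxab
      have hcont : ContinuousWithinAt (fun t => m (R t)) (Set.Icc a b) x :=
        (hmc.comp hR hRpos) x hxI
      have hmx := hmpos _ (hRpos x hxI)
      have hev := (hcont.mono_of_mem_nhdsWithin
        (Icc_mem_nhdsGT_of_mem hxab)).eventually_lt_const
          (show m (R x) < (1 + ε) * m (R x) by nlinarith)
      obtain ⟨z, hz, hzI, hzy⟩ :=
        (hev.and (Filter.Eventually.and (p := (· ∈ Set.Icc a b)) (q := (· ∈ Set.Ioc x y))
          (Icc_mem_nhdsGT_of_mem hxab) (Ioc_mem_nhdsGT hxy))).exists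
      refine ⟨z, ?_, hzy⟩
      have hxz : x ≤ z := hzy.1.le
      have hRxz := hRmono hxI hzI hxz
      have hGxz := hGmono hxI hzI hxz
      have hstep : ∫ r in (R x)..(R z), 1 / m r ≤ (1 + ε) * (G z - G x) := by
        calc ∫ r in (R x)..(R z), 1 / m r
            ≤ ∫ _ in (R x)..(R z), 1 / m (R x) := by
              refine intervalIntegral.integral_mono_on hRxz
                (hint _ _ (hRpos x hxI) (hRpos z hzI)) intervalIntegrable_const fun r hr => ?_
              have hr0 : 0 < r := (hRpos x hxI).trans_le hr.1
              exact one_div_le_one_div_of_le hmx (hmmono (hRpos x hxI) hr0 hr.1)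
          _ = (R z - R x) / m (R x) := by
              simp [div_eq_mul_inv]
          _ ≤ (1 + ε) * (G z - G x) := by
              rw [div_le_iff₀ hmx]
              have h1 := hinc x hxI z hzI hxz
              have h2 := mul_le_mul_of_nonneg_right hz.le (sub_nonneg.2 hGxz)
              nlinarith
      have hadd := intervalIntegral.integral_add_adjacent_intervals
        (hint (R a) (R x) (hRpos a ha) (hRpos x hxI))
        (hint (R x) (R z) (hRpos x hxI) (hRpos z hzI))
      simp only [Set.mem_ofPred_eq] at hx ⊢
      rw [← hadd]
      linarith
  have hG0 : 0 ≤ G t - G a := sub_nonneg.2 (hGmono ha ht ht.1)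
  refine le_of_forall_pos_le_add fun δ hδ => ?_
  have h1 := key (δ / (G t - G a + 1)) (by positivity)
  have h2 : δ / (G t - G a + 1) * (G t - G a) ≤ δ := by
    rw [div_mul_eq_mul_div, div_le_iff₀ (by positivity)]
    nlinarith
  linarith

/-- Osgood's Lemma: if `ρ(t) ≤ β + ∫_{t₀}^t γ(s) μ(ρ(s)) ds` on `[t₀, T]`, with `ρ`
measurable, bounded and positive, `γ` integrable and positive, `μ` continuous,
increasing and positive on `(0,∞)`, then
`−Φ(ρ(t)) + Φ(β) ≤ ∫_{t₀}^t γ(s) ds` where `Φ(x) = ∫_x^1 dr/μ(r)`. -/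
theorem osgood_lemma (t₀ T : ℝ) (hT : t₀ < T) (ρ γ μ : ℝ → ℝ) (β : ℝ) (hβ : 0 < β)
    (hρm : Measurable ρ) (hρb : ∃ B, ∀ t ∈ Set.Icc t₀ T, ρ t ≤ B)
    (hρpos : ∀ t ∈ Set.Icc t₀ T, 0 < ρ t)
    (hγpos : ∀ t ∈ Set.Icc t₀ T, 0 < γ t)
    (hγint : IntegrableOn γ (Set.Icc t₀ T))
    (hμc : ContinuousOn μ (Set.Ioi 0)) (hμmono : MonotoneOn μ (Set.Ioi 0))
    (hμpos : ∀ x > (0 : ℝ), 0 < μ x)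
    (hineq : ∀ t ∈ Set.Icc t₀ T, ρ t ≤ β + ∫ s in t₀..t, γ s * μ (ρ s)) :
    ∀ t ∈ Set.Icc t₀ T,
      -(∫ r in (ρ t)..1, 1 / μ r) + (∫ r in β..1, 1 / μ r) ≤ ∫ s in t₀..t, γ s := by
  obtain ⟨B, hB⟩ := hρb
  have h₀ : t₀ ∈ Set.Icc t₀ T := Set.left_mem_Icc.2 hT.le
  have hmeas : AEStronglyMeasurable (fun s => μ (ρ s)) (volume.restrict (Set.Icc t₀ T)) := by
    have hind : Measurable ((Set.Ioi (0 : ℝ)).indicator μ) := by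
      classical
      rw [← Set.piecewise_eq_indicator]
      exact hμc.measurable_piecewise continuousOn_const measurableSet_Ioi
    refine ((hind.comp hρm).aestronglyMeasurable).congr ?_
    filter_upwards [ae_restrict_mem measurableSet_Icc] with s hs
    simp [Set.indicator_of_mem (show ρ s ∈ Set.Ioi 0 from hρpos s hs)]
  have hprod : IntegrableOn (fun s => γ s * μ (ρ s)) (Set.Icc t₀ T) := by
    refine Integrable.mul_bdd (c := μ B) hγint hmeas ?_
    filter_upwards [ae_restrict_mem measurableSet_Icc] with s hs
    rw [Real.norm_of_nonneg (hμpos _ (hρpos s hs)).le]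
    exact hμmono (hρpos s hs) ((hρpos s hs).trans_le (hB s hs)) (hB s hs)
  have hsub : ∀ x ∈ Set.Icc t₀ T, ∀ y ∈ Set.Icc t₀ T, Set.uIcc x y ⊆ Set.Icc t₀ T :=
    fun x hx y hy => Set.uIcc_subset_Icc hx hy
  have hii : ∀ f : ℝ → ℝ, IntegrableOn f (Set.Icc t₀ T) → ∀ x ∈ Set.Icc t₀ T,
      ∀ y ∈ Set.Icc t₀ T, IntervalIntegrable f volume x y := fun f hf x hx y hy =>
    (hf.mono_set (hsub x hx y hy)).intervalIntegrable
  have hprim : ∀ f : ℝ → ℝ, IntegrableOn f (Set.Icc t₀ T) →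
      ContinuousOn (fun t => ∫ s in t₀..t, f s) (Set.Icc t₀ T) := by
    intro f hf
    rw [← Set.uIcc_of_le hT.le] at hf ⊢
    exact intervalIntegral.continuousOn_primitive_interval hf
  have hincr : ∀ f : ℝ → ℝ, IntegrableOn f (Set.Icc t₀ T) → ∀ x ∈ Set.Icc t₀ T,
      ∀ y ∈ Set.Icc t₀ T, (∫ s in t₀..y, f s) - ∫ s in t₀..x, f s = ∫ s in x..y, f s :=
    fun f hf x hx y hy =>
      intervalIntegral.integral_interval_sub_left (hii f hf _ h₀ _ hy) (hii f hf _ h₀ _ hx)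
  have hmono : ∀ f : ℝ → ℝ, IntegrableOn f (Set.Icc t₀ T) → (∀ s ∈ Set.Icc t₀ T, 0 ≤ f s) →
      MonotoneOn (fun t => ∫ s in t₀..t, f s) (Set.Icc t₀ T) := by
    intro f hf hf0 x hx y hy hxy
    rw [← sub_nonneg, hincr f hf x hx y hy]
    exact intervalIntegral.integral_nonneg hxy fun s hs =>
      hf0 s ⟨hx.1.trans hs.1, hs.2.trans hy.2⟩
  have hprod0 : ∀ s ∈ Set.Icc t₀ T, 0 ≤ γ s * μ (ρ s) := fun s hs =>
    mul_nonneg (hγpos s hs).le (hμpos _ (hρpos s hs)).le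
  set R : ℝ → ℝ := fun t => β + ∫ s in t₀..t, γ s * μ (ρ s) with hRdef
  have hRc : ContinuousOn R (Set.Icc t₀ T) := continuousOn_const.add (hprim _ hprod)
  have hRmono : MonotoneOn R (Set.Icc t₀ T) := fun x hx y hy hxy =>
    add_le_add_right (hmono _ hprod hprod0 hx hy hxy) β
  have hRpos : ∀ t ∈ Set.Icc t₀ T, 0 < R t := fun s hs => (hρpos s hs).trans_le (hineq s hs)
  have hR₀ : R t₀ = β := by simp [hRdef]
  intro t ht
  have main := integral_one_div_le_of_increment_le hRc hRmono hRpos (hprim γ hγint)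
    (hmono γ hγint fun s hs => (hγpos s hs).le) hμc hμmono hμpos ?_ t ht
  · have hint : ∀ x y : ℝ, 0 < x → 0 < y →
        IntervalIntegrable (fun r => 1 / μ r) volume x y := fun x y hx hy =>
      ((continuousOn_const.div hμc fun x hx => (hμpos x hx).ne').mono
        fun z hz => lt_of_lt_of_le (lt_min hx hy) hz.1).intervalIntegrable
    rw [hR₀] at main
    simp only [intervalIntegral.integral_same, sub_zero] at main
    have hρt := hρpos t ht
    have h1 := intervalIntegral.integral_add_adjacent_intervals
      (hint β (ρ t) hβ hρt) (hint (ρ t) 1 hρt one_pos)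
    have h2 := intervalIntegral.integral_add_adjacent_intervals
      (hint β (ρ t) hβ hρt) (hint (ρ t) (R t) hρt (hRpos t ht))
    have h3 : 0 ≤ ∫ r in (ρ t)..(R t), 1 / μ r :=
      intervalIntegral.integral_nonneg (hineq t ht) fun r hr =>
        (one_div_pos.2 (hμpos r (hρt.trans_le hr.1))).le
    linarith
  · intro x hx y hy hxy
    have hRR : R y - R x = ∫ s in x..y, γ s * μ (ρ s) := by
      rw [← hincr _ hprod x hx y hy]
      simp [hRdef]
    rw [hRR, hincr γ hγint x hx y hy, mul_comm, ← intervalIntegral.integral_mul_const]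
    refine intervalIntegral.integral_mono_on hxy (hii _ hprod x hx y hy)
      ((hii γ hγint x hx y hy).mul_const _) fun s hs => ?_
    have hsI : s ∈ Set.Icc t₀ T := ⟨hx.1.trans hs.1, hs.2.trans hy.2⟩
    exact mul_le_mul_of_nonneg_left (hμmono (hρpos s hsI) (hRpos y hy)
      ((hineq s hsI).trans (hRmono hsI hy hs.2))) (hγpos s hsI).le
end

section
/- (Osgood-type a priori bound.) Let C > 0, M ≥ 1, T > 0, B ∈ (0, 1), and let δ : [0, T] → (0, 1] be continuous and satisfy δ(t) ≤ B + C M ∫₀^t δ(s)(3 − log δ(s)) ds for all t ∈ [0, T]. Then for all t ∈ [0, T], δ(t) ≤ e³ · B^{exp(−C M t)}. -/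
theorem mul_three_sub_log_le {x y : ℝ} (hx : 0 < x) (hxy : x ≤ y) (hy : y ≤ 1) :
    x * (3 - Real.log x) ≤ y * (3 - Real.log y) := by
  have hlog : Real.log y ≤ 0 := Real.log_nonpos (hx.le.trans hxy) hy
  have hdiv : x * (Real.log y - Real.log x) ≤ y - x := by
    rw [← Real.log_div (hx.trans_le hxy).ne' hx.ne']
    calc x * Real.log (y / x) ≤ x * (y / x - 1) :=
          mul_le_mul_of_nonneg_left
            (Real.log_le_sub_one_of_pos (div_pos (hx.trans_le hxy) hx)) hx.le
      _ = y - x := by field_simp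
  nlinarith [mul_nonneg (sub_nonneg.2 hxy) (neg_nonneg.2 hlog)]

/-- The barrier solves `G' = k G (a - log G)`. Choosing `a > 3` gives a strict supersolution. -/
theorem hasDerivAt_osgood_barrier (a b k x : ℝ) :
    HasDerivAt (fun s ↦ Real.exp (a - (a - b) * Real.exp (-(k * s))))
      (Real.exp (a - (a - b) * Real.exp (-(k * x))) *
        (k * ((a - b) * Real.exp (-(k * x))))) x := by
  have h : HasDerivAt (fun s : ℝ ↦ -(k * s)) (-k) x := by
    simpa using ((hasDerivAt_id x).const_mul (-k))
  convert ((h.exp.const_mul (a - b)).const_sub a).exp using 1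
  ring

/-- Osgood-type a priori bound: if `δ : [0,T] → (0,1]` is continuous and
`δ(t) ≤ B + C M ∫₀^t δ(s)(3 − log δ(s)) ds`, then `δ(t) ≤ e³ B^{exp(−C M t)}`. -/
theorem osgood_apriori_bound (C M T B : ℝ) (hC : 0 < C) (hM : 1 ≤ M) (hT : 0 < T)
    (hB : 0 < B) (hB1 : B < 1) (δ : ℝ → ℝ) (hδc : ContinuousOn δ (Set.Icc 0 T))
    (hδ : ∀ t ∈ Set.Icc 0 T, 0 < δ t ∧ δ t ≤ 1)
    (hineq : ∀ t ∈ Set.Icc 0 T,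
      δ t ≤ B + C * M * ∫ s in (0 : ℝ)..t, δ s * (3 - Real.log (δ s))) :
    ∀ t ∈ Set.Icc 0 T, δ t ≤ Real.exp 3 * B ^ Real.exp (-(C * M * t)) := by
  intro t ht
  have hk : 0 < C * M := mul_pos hC (one_pos.trans_le hM)
  set k := C * M
  have hlogB : Real.log B < 0 := Real.log_neg hB hB1
  rw [Real.rpow_def_of_pos hB, ← Real.exp_add]
  rcases ht.1.eq_or_lt with rfl | ht0
  · have h0 : δ 0 ≤ B := by simpa using hineq 0 ht
    calc δ 0 ≤ Real.exp (Real.log B) := by rwa [Real.exp_log hB]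
      _ ≤ _ := Real.exp_le_exp.2 (by simp)
  have hE : Real.exp (-(k * t)) < 1 := Real.exp_lt_one_iff.2 (neg_neg_of_pos (mul_pos hk ht0))
  obtain ⟨a, ha3, hat⟩ : ∃ a : ℝ, 3 < a ∧ a - a * Real.exp (-(k * t)) = 3 := by
    have hpos : 0 < 1 - Real.exp (-(k * t)) := sub_pos.2 hE
    refine ⟨3 / (1 - Real.exp (-(k * t))), ?_, by field_simp⟩
    rw [lt_div_iff₀ hpos]
    linarith [Real.exp_pos (-(k * t))]
  have hend : 3 + Real.log B * Real.exp (-(k * t)) =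
      a - (a - Real.log B) * Real.exp (-(k * t)) := by linarith
  rw [hend]
  rcases le_or_gt 0 (a - (a - Real.log B) * Real.exp (-(k * t))) with hnonneg | hneg
  · exact (hδ t ht).2.trans (Real.one_le_exp hnonneg)
  let ψ : ℝ → ℝ := Set.IccExtend hT.le ((Set.Icc 0 T).domRestrict δ)
  have hψc : Continuous ψ := hδc.domRestrict.Icc_extend'
  have hψ : ∀ s ∈ Set.Icc 0 T, ψ s = δ s := fun s hs ↦ Set.IccExtend_of_mem hT.le _ hs
  have hψpos : ∀ s, 0 < ψ s := fun s ↦ (hδ _ (Set.projIcc 0 T hT.le s).2).1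
  have hφc : Continuous fun s ↦ ψ s * (3 - Real.log (ψ s)) :=
    hψc.mul (continuous_const.sub (hψc.log fun s ↦ (hψpos s).ne'))
  let V : ℝ → ℝ := fun x ↦ B + k * ∫ s in (0 : ℝ)..x, ψ s * (3 - Real.log (ψ s))
  have hVd : ∀ x, HasDerivAt V (k * (ψ x * (3 - Real.log (ψ x)))) x := fun x ↦
    ((hφc.integral_hasStrictDerivAt 0 x).hasDerivAt.const_mul k).const_add B
  have hδV : ∀ x ∈ Set.Icc 0 T, δ x ≤ V x := by
    intro x hx
    refine (hineq x hx).trans_eq ?_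
    congr 2
    refine intervalIntegral.integral_congr fun s hs ↦ ?_
    rw [Set.uIcc_of_le hx.1] at hs
    simp only [hψ s ⟨hs.1, hs.2.trans hx.2⟩]
  refine (hδV t ht).trans ?_
  refine image_le_of_deriv_right_lt_deriv_boundary
    (fun x _ ↦ (hVd x).continuousAt.continuousWithinAt)
    (fun x _ ↦ (hVd x).hasDerivWithinAt) ?_
    (hasDerivAt_osgood_barrier a (Real.log B) k) ?_ ⟨ht0.le, le_rfl⟩
  · simp [V, Real.exp_log hB]
  · intro x hx hVx
    have hxT : x ∈ Set.Icc 0 T := ⟨hx.1, hx.2.le.trans ht.2⟩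
    have hmono : Real.exp (-(k * t)) ≤ Real.exp (-(k * x)) :=
      Real.exp_le_exp.2 (neg_le_neg (mul_le_mul_of_nonneg_left hx.2.le hk.le))
    set g := a - (a - Real.log B) * Real.exp (-(k * x)) with hg
    have hg0 : g ≤ 0 := by
      have := mul_le_mul_of_nonneg_left hmono (by linarith : 0 ≤ a - Real.log B)
      linarith
    have hle : ψ x ≤ Real.exp g := by
      rw [hψ x hxT, ← hVx]
      exact hδV x hxT
    have hosgood := mul_three_sub_log_le (hψpos x) hle (Real.exp_le_one_iff.2 hg0)
    rw [Real.log_exp] at hosgood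
    calc k * (ψ x * (3 - Real.log (ψ x))) ≤ k * (Real.exp g * (3 - g)) :=
          mul_le_mul_of_nonneg_left hosgood hk.le
      _ < k * (Real.exp g * (a - g)) := by gcongr
      _ = _ := by rw [hg]; ring
end
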